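/- Let n ∈ ℕ, T > 0, x ∈ ℝ^n, and for t > 0 let P_t denote the Euclidean heat semigroup, P_t h(y) = ∫_{ℝ^n} h(y + √t·z) dγ_n(z). Let f: ℝ^n → ℝ be a smooth positive function (with suitable integrability and regularity so that all appearing quantities are finite) with ∫_{ℝ^n} f d(P_T δ_x) = 1, i.e., P_T f(x) = 1, where P_T δ_x is the Gaussian measure with density y ↦ (2πT)^{-n/2} e^{-|y−x|²/(2T)}. Let μ be the probability measure with dμ/d(P_T δ_x) = f. Then H(μ‖P_T δ_x) ≤ (T/2)·ΔP_T f(x) + (1/2)·P_T f(x)·log det( Id_n − T · P_T(f ∇² log f)(x) / P_T f(x) ), where H(μ‖P_T δ_x) = P_T(f log f)(x) − P_T f(x) · log P_T f(x). -/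

import Mathlib

open MeasureTheory

/-- The `k`-th partial derivative of a function on `ℝⁿ`. -/
noncomputable def pderiv' {n : ℕ} (f : (Fin n → ℝ) → ℝ) (k : Fin n) (x : Fin n → ℝ) : ℝ :=
  fderiv ℝ f x (Pi.single k 1)

/-- The standard Gaussian measure `γₙ` on `ℝⁿ`. -/
noncomputable def stdGauss (n : ℕ) : Measure (Fin n → ℝ) :=
  volume.withDensity fun x =>
    ENNReal.ofReal ((2 * Real.pi) ^ (-(n : ℝ) / 2) * Real.exp (-(∑ i, x i ^ 2) / 2))

/-- The Euclidean heat semigroup `P_t h(y) = ∫ h(y + √t z) dγₙ(z)`. -/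
noncomputable def heatSG {n : ℕ} (t : ℝ) (h : (Fin n → ℝ) → ℝ) (y : Fin n → ℝ) : ℝ :=
  ∫ z, h (y + Real.sqrt t • z) ∂(stdGauss n)

/-- The Hessian matrix `∇²g(x)` of a function `g : ℝⁿ → ℝ`. -/
noncomputable def hessian {n : ℕ} (g : (Fin n → ℝ) → ℝ) (x : Fin n → ℝ) :
    Matrix (Fin n) (Fin n) ℝ :=
  Matrix.of fun i j => pderiv' (fun y => pderiv' g j y) i x

section Cutoff

open Filter Topology

theorem fderiv_comp_smul_apply {E : Type*} [NormedAddCommGroup E] [NormedSpace ℝ E] {ψ : E → ℝ}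
    (hψ : Differentiable ℝ ψ) (c : ℝ) (v x : E) :
    fderiv ℝ (fun y => ψ (c • y)) x v = c * fderiv ℝ ψ (c • x) v := by
  have h : HasFDerivAt (fun y => ψ (c • y))
      ((fderiv ℝ ψ (c • x)).comp (c • ContinuousLinearMap.id ℝ E)) x :=
    (hψ (c • x)).hasFDerivAt.comp x ((hasFDerivAt_id x).const_smul c)
  rw [h.fderiv]
  simp

theorem tendsto_integral_mul_of_abs_le {α : Type*} [MeasurableSpace α] {μ : Measure α} {C : ℝ}
    {w : ℕ → α → ℝ} {u : α → ℝ} (hu : Integrable u μ)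
    (hw : ∀ k x, |w k x| ≤ C / (k + 1)) :
    Tendsto (fun k => ∫ x, w k x * u x ∂μ) atTop (𝓝 0) := by
  have h0 : Tendsto (fun k : ℕ => C / ((k : ℝ) + 1) * ∫ x, ‖u x‖ ∂μ) atTop (𝓝 0) := by
    have := (tendsto_const_div_atTop_nhds_zero_nat C).comp (tendsto_add_atTop_nat 1)
    simpa using (this.mul_const (∫ x, ‖u x‖ ∂μ))
  refine squeeze_zero_norm (fun k => ?_) h0
  rw [← integral_const_mul]
  refine norm_integral_le_of_norm_le (hu.norm.const_mul _) (ae_of_all _ fun x => ?_)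
  rw [norm_mul]
  exact mul_le_mul_of_nonneg_right (hw k x) (norm_nonneg _)

variable {E : Type*} [NormedAddCommGroup E] [NormedSpace ℝ E] [FiniteDimensional ℝ E]

/-- `χ` is a sequence of smooth compactly supported cutoffs whose first two derivatives in the
direction `v` are small. -/
structure IsCutoffSeq (v : E) (C : ℝ) (χ : ℕ → E → ℝ) : Prop where
  contDiff : ∀ k, ContDiff ℝ 2 (χ k)
  hasCompactSupport : ∀ k, HasCompactSupport (χ k)
  nonneg : ∀ k x, 0 ≤ χ k x
  le_one : ∀ k x, χ k x ≤ 1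
  eq_one : ∀ k : ℕ, ∀ x ∈ Metric.ball (0 : E) (k + 1), χ k x = 1
  abs_fderiv_le : ∀ k x, |fderiv ℝ (χ k) x v| ≤ C / (k + 1)
  abs_fderiv_fderiv_le : ∀ k x, |fderiv ℝ (fun y => fderiv ℝ (χ k) y v) x v| ≤ C / (k + 1)

theorem exists_isCutoffSeq (v : E) : ∃ C χ, IsCutoffSeq v C χ := by
  let ψ : ContDiffBump (0 : E) := ⟨1, 2, one_pos, one_lt_two⟩
  have hψ : ContDiff ℝ 3 (ψ : E → ℝ) := ψ.contDiff
  have h1 : ContDiff ℝ 2 (fun y => fderiv ℝ ψ y v) :=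
    (hψ.fderiv_right (m := 2) (by norm_num)).clm_apply contDiff_const
  have h2 : ContDiff ℝ 1 (fun x => fderiv ℝ (fun y => fderiv ℝ ψ y v) x v) :=
    (h1.fderiv_right (m := 1) (by norm_num)).clm_apply contDiff_const
  have s1 : HasCompactSupport (fun y => fderiv ℝ ψ y v) := ψ.hasCompactSupport.fderiv_apply ℝ v
  have s2 : HasCompactSupport (fun x => fderiv ℝ (fun y => fderiv ℝ ψ y v) x v) :=
    s1.fderiv_apply ℝ v
  obtain ⟨C1, hC1⟩ := s1.exists_bound_of_continuous h1.continuous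
  obtain ⟨C2, hC2⟩ := s2.exists_bound_of_continuous h2.continuous
  have hc : ∀ k : ℕ, (0 : ℝ) < ((k : ℝ) + 1)⁻¹ := fun k => by positivity
  have hc1 : ∀ k : ℕ, ((k : ℝ) + 1)⁻¹ ≤ 1 := fun k => inv_le_one_of_one_le₀ (by simp)
  have hd : ∀ k : ℕ, (fun y => fderiv ℝ (fun y => ψ (((k : ℝ) + 1)⁻¹ • y)) y v) =
      fun y => ((k : ℝ) + 1)⁻¹ * fderiv ℝ ψ (((k : ℝ) + 1)⁻¹ • y) v := fun k => by
    ext y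
    exact fderiv_comp_smul_apply (hψ.differentiable (by norm_num)) _ v y
  refine ⟨max C1 C2, fun k x => ψ (((k : ℝ) + 1)⁻¹ • x), ?_, ?_, ?_, ?_, ?_, ?_, ?_⟩
  · intro k
    exact (hψ.of_le (by norm_num)).comp (contDiff_const_smul _)
  · intro k
    exact ψ.hasCompactSupport.comp_smul (hc k).ne'
  · exact fun k x => ψ.nonneg
  · exact fun k x => ψ.le_one
  · intro k x hx
    apply ψ.one_of_mem_closedBall
    have hx' : ‖x‖ < k + 1 := by simpa using hx
    have : ((k : ℝ) + 1)⁻¹ * ‖x‖ ≤ 1 := by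
      rw [inv_mul_le_iff₀ (by positivity)]
      linarith
    simpa [ψ, norm_smul, abs_of_pos (hc k), abs_of_pos (show (0 : ℝ) < k + 1 by positivity)]
      using this
  · intro k x
    rw [congrFun (hd k) x, abs_mul, abs_of_pos (hc k), div_eq_inv_mul]
    gcongr
    exact (hC1 _).trans (le_max_left _ _)
  · intro k x
    have hdiff : DifferentiableAt ℝ (fun y => fderiv ℝ ψ (((k : ℝ) + 1)⁻¹ • y) v) x :=
      DifferentiableAt.comp x (h1.differentiable (by norm_num) _)
        (differentiableAt_id.const_smul ((k : ℝ) + 1)⁻¹)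
    rw [hd k, fderiv_const_mul hdiff, smul_apply,
      fderiv_comp_smul_apply (h1.differentiable (by norm_num)), smul_eq_mul, abs_mul, abs_mul,
      abs_of_pos (hc k), div_eq_inv_mul]
    gcongr
    calc ((k : ℝ) + 1)⁻¹ * |fderiv ℝ (fun y => fderiv ℝ ψ y v) (((k : ℝ) + 1)⁻¹ • x) v|
        ≤ 1 * C2 := by
          gcongr
          · exact hc1 k
          · exact hC2 _
      _ ≤ max C1 C2 := by simp

variable [MeasurableSpace E] [BorelSpace E] {μ : Measure E} [μ.IsAddHaarMeasure]

/-- If `a` is integrable, `b` is nonnegative and the cut-off integrals of `a + b` vanish in the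
limit, then `b` is integrable and its integral is minus that of `a`. -/
theorem IsCutoffSeq.integrable_and_integral_eq {v : E} {C : ℝ} {χ : ℕ → E → ℝ}
    (hχ : IsCutoffSeq v C χ) {a b : E → ℝ} (ha : Integrable a μ) (hb : Continuous b)
    (hb0 : ∀ x, 0 ≤ b x)
    (hlim : Tendsto (fun k => ∫ x, χ k x * (a x + b x) ∂μ) atTop (𝓝 0)) :
    Integrable b μ ∧ ∫ x, b x ∂μ = -∫ x, a x ∂μ := by
  have hcont : ∀ k, Continuous (χ k) := fun k => (hχ.contDiff k).continuous
  have hab : ∀ k x, ‖χ k x‖ ≤ 1 := fun k x => by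
    rw [Real.norm_eq_abs, abs_of_nonneg (hχ.nonneg k x)]
    exact hχ.le_one k x
  have hia : ∀ k, Integrable (fun x => χ k x * a x) μ := fun k =>
    ha.bdd_mul (hcont k).aestronglyMeasurable (ae_of_all _ (hab k))
  have hib : ∀ k, Integrable (fun x => χ k x * b x) μ := fun k =>
    ((hcont k).mul hb).integrable_of_hasCompactSupport (hχ.hasCompactSupport k).mul_right
  have hpt : ∀ x, Tendsto (fun k => χ k x) atTop (𝓝 1) := fun x => by
    refine tendsto_const_nhds.congr' ?_
    filter_upwards [eventually_ge_atTop ⌈‖x‖⌉₊] with k hk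
    refine (hχ.eq_one k x ?_).symm
    have : ‖x‖ ≤ k := Nat.ceil_le.mp hk
    simp
    linarith
  have hdct : ∀ {w : E → ℝ}, Integrable w μ →
      Tendsto (fun k => ∫ x, χ k x * w x ∂μ) atTop (𝓝 (∫ x, w x ∂μ)) := fun {w} hw => by
    refine tendsto_integral_of_dominated_convergence (fun x => ‖w x‖)
      (fun k => (hcont k).aestronglyMeasurable.mul hw.1) hw.norm (fun k => ae_of_all _ fun x => ?_)
      (ae_of_all _ fun x => ?_)
    · rw [norm_mul]
      exact mul_le_of_le_one_left (norm_nonneg _) (hab k x)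
    · simpa using (hpt x).mul_const (w x)
  have hlimb : Tendsto (fun k => ∫ x, χ k x * b x ∂μ) atTop (𝓝 (-∫ x, a x ∂μ)) := by
    have := hlim.sub (hdct ha)
    rw [zero_sub] at this
    refine this.congr fun k => ?_
    rw [← integral_sub _ (hia k)]
    · congr 1 with x
      ring
    · simp only [mul_add]
      exact (hia k).add (hib k)
  have hbi : Integrable b μ := by
    have hcov : AECover μ atTop (fun k : ℕ => Metric.ball (0 : E) ((k : ℝ) + 1)) :=
      aecover_ball (tendsto_atTop_add_const_right _ _ tendsto_natCast_atTop_atTop)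
    refine hcov.integrable_of_integral_norm_bounded (-∫ x, a x ∂μ + 1) (fun k => ?_) ?_
    · exact (hb.locallyIntegrable.integrableOn_isCompact
        (isCompact_closedBall (0 : E) ((k : ℝ) + 1))).mono_set Metric.ball_subset_closedBall
    · filter_upwards [hlimb.eventually_le_const (lt_add_one _)] with k hk
      refine le_trans ?_ hk
      calc ∫ x in Metric.ball (0 : E) ((k : ℝ) + 1), ‖b x‖ ∂μ
          = ∫ x in Metric.ball (0 : E) ((k : ℝ) + 1), χ k x * b x ∂μ := by
            refine setIntegral_congr_fun Metric.isOpen_ball.measurableSet fun x hx => ?_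
            rw [hχ.eq_one k x hx, one_mul, Real.norm_of_nonneg (hb0 x)]
        _ ≤ ∫ x, χ k x * b x ∂μ := setIntegral_le_integral (hib k)
            (ae_of_all _ fun x => mul_nonneg (hχ.nonneg k x) (hb0 x))
  exact ⟨hbi, tendsto_nhds_unique (hdct hbi) hlimb⟩

theorem integral_cutoff_mul_fderiv {χ u : E → ℝ} (v : E) (hχ : ContDiff ℝ 1 χ)
    (hs : HasCompactSupport χ) (hu : ContDiff ℝ 1 u) :
    ∫ x, χ x * fderiv ℝ u x v ∂μ = -∫ x, fderiv ℝ χ x v * u x ∂μ := by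
  have c1 : Continuous (fun x => fderiv ℝ χ x v) :=
    (hχ.continuous_fderiv (by norm_num)).clm_apply continuous_const
  have c2 : Continuous (fun x => fderiv ℝ u x v) :=
    (hu.continuous_fderiv (by norm_num)).clm_apply continuous_const
  refine integral_mul_fderiv_eq_neg_fderiv_mul_of_integrable ?_ ?_ ?_
    (fun x _ => hχ.differentiable (by norm_num) x) (fun x _ => hu.differentiable (by norm_num) x)
  · exact (c1.mul hu.continuous).integrable_of_hasCompactSupport (hs.fderiv_apply ℝ v).mul_right
  · exact (hχ.continuous.mul c2).integrable_of_hasCompactSupport hs.mul_right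
  · exact (hχ.continuous.mul hu.continuous).integrable_of_hasCompactSupport hs.mul_right

theorem integrable_and_integral_eq_of_fderiv_eq_add {u a b : E → ℝ} (v : E) (hu : ContDiff ℝ 1 u)
    (hui : Integrable u μ) (hd : ∀ x, fderiv ℝ u x v = a x + b x) (ha : Integrable a μ)
    (hb : Continuous b) (hb0 : ∀ x, 0 ≤ b x) :
    Integrable b μ ∧ ∫ x, b x ∂μ = -∫ x, a x ∂μ := by
  obtain ⟨C, χ, hχ⟩ := exists_isCutoffSeq v
  refine hχ.integrable_and_integral_eq ha hb hb0 ?_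
  have h := (tendsto_integral_mul_of_abs_le hui hχ.abs_fderiv_le).neg
  rw [neg_zero] at h
  refine h.congr fun k => ?_
  rw [← integral_cutoff_mul_fderiv v ((hχ.contDiff k).of_le (by norm_num))
    (hχ.hasCompactSupport k) hu]
  simp only [hd]

theorem integrable_and_integral_eq_of_fderiv_fderiv_eq_add {u a b : E → ℝ} (v : E)
    (hu : ContDiff ℝ 2 u) (hui : Integrable u μ)
    (hd : ∀ x, fderiv ℝ (fun y => fderiv ℝ u y v) x v = a x + b x) (ha : Integrable a μ)
    (hb : Continuous b) (hb0 : ∀ x, 0 ≤ b x) :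
    Integrable b μ ∧ ∫ x, b x ∂μ = -∫ x, a x ∂μ := by
  obtain ⟨C, χ, hχ⟩ := exists_isCutoffSeq v
  refine hχ.integrable_and_integral_eq ha hb hb0 ?_
  refine (tendsto_integral_mul_of_abs_le hui hχ.abs_fderiv_fderiv_le).congr fun k => ?_
  have hu1 : ContDiff ℝ 1 (fun y => fderiv ℝ u y v) :=
    (hu.fderiv_right (m := 1) (by norm_num)).clm_apply contDiff_const
  have hχ1 : ContDiff ℝ 1 (fun y => fderiv ℝ (χ k) y v) :=
    ((hχ.contDiff k).fderiv_right (m := 1) (by norm_num)).clm_apply contDiff_const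
  have e1 := integral_cutoff_mul_fderiv (μ := μ) v ((hχ.contDiff k).of_le (by norm_num))
    (hχ.hasCompactSupport k) hu1
  have e2 := integral_cutoff_mul_fderiv (μ := μ) v hχ1
    ((hχ.hasCompactSupport k).fderiv_apply ℝ v) (hu.of_le (by norm_num))
  simp only [← hd]
  rw [e1, e2, neg_neg]

end Cutoff

section OneDim

open Filter Topology Set

/-- The cumulative distribution function of a density on the line. -/
noncomputable def densityCDF (ρ : ℝ → ℝ) (x : ℝ) : ℝ := ∫ t in Iic x, ρ t

variable {ρ φ : ℝ → ℝ}

theorem densityCDF_eq (hi : Integrable ρ) (x : ℝ) :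
    densityCDF ρ x = (∫ t in Iic 0, ρ t) + ∫ t in (0 : ℝ)..x, ρ t := by
  rw [← intervalIntegral.integral_Iic_sub_Iic hi.integrableOn hi.integrableOn]
  simp [densityCDF]

theorem hasDerivAt_densityCDF (hc : Continuous ρ) (hi : Integrable ρ) (x : ℝ) :
    HasDerivAt (densityCDF ρ) (ρ x) x := by
  rw [show densityCDF ρ = fun x => (∫ t in Iic 0, ρ t) + ∫ t in (0 : ℝ)..x, ρ t from
    funext (densityCDF_eq hi)]
  exact (intervalIntegral.integral_hasDerivAt_right (hc.intervalIntegrable _ _)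
    (hc.stronglyMeasurableAtFilter _ _) hc.continuousAt).const_add _

theorem strictMono_densityCDF (hc : Continuous ρ) (hi : Integrable ρ) (hpos : ∀ x, 0 < ρ x) :
    StrictMono (densityCDF ρ) :=
  strictMono_of_deriv_pos fun x => by rw [(hasDerivAt_densityCDF hc hi x).deriv]; exact hpos x

theorem tendsto_densityCDF_atTop (hi : Integrable ρ) :
    Tendsto (densityCDF ρ) atTop (𝓝 (∫ t, ρ t)) := by
  rw [show densityCDF ρ = fun x => (∫ t in Iic 0, ρ t) + ∫ t in (0 : ℝ)..x, ρ t from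
    funext (densityCDF_eq hi), ← intervalIntegral.integral_Iic_add_Ioi hi.integrableOn
      (b := 0) hi.integrableOn]
  exact (intervalIntegral_tendsto_integral_Ioi 0 hi.integrableOn tendsto_id).const_add _

theorem tendsto_densityCDF_atBot (hi : Integrable ρ) :
    Tendsto (densityCDF ρ) atBot (𝓝 0) := by
  rw [show densityCDF ρ = fun x => (∫ t in Iic 0, ρ t) - ∫ t in x..(0 : ℝ), ρ t from
    funext fun x => by
      rw [densityCDF_eq hi, intervalIntegral.integral_symm, sub_eq_add_neg]]
  have h := (intervalIntegral_tendsto_integral_Iic 0 hi.integrableOn tendsto_id).const_sub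
    (∫ t in Iic (0 : ℝ), ρ t)
  rw [sub_self] at h
  exact h

theorem range_densityCDF (hc : Continuous ρ) (hi : Integrable ρ) (hpos : ∀ x, 0 < ρ x)
    (hm : ∫ t, ρ t = 1) : range (densityCDF ρ) = Ioo 0 1 := by
  have hmono := strictMono_densityCDF hc hi hpos
  have hbot := tendsto_densityCDF_atBot hi
  have htop := hm ▸ tendsto_densityCDF_atTop hi
  have hcont : Continuous (densityCDF ρ) :=
    continuous_iff_continuousAt.2 fun x => (hasDerivAt_densityCDF hc hi x).continuousAt
  ext c
  constructor
  · rintro ⟨x, rfl⟩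
    exact ⟨(hmono.monotone.le_of_tendsto hbot (x - 1)).trans_lt (hmono (by linarith)),
      (hmono (show x < x + 1 by linarith)).trans_le (hmono.monotone.ge_of_tendsto htop _)⟩
  · rintro ⟨h0, h1⟩
    obtain ⟨a, ha⟩ := (hbot.eventually_lt_const h0).exists
    obtain ⟨b, hb⟩ := (htop.eventually_const_lt h1).exists
    exact mem_range_of_exists_le_of_exists_ge hcont ⟨a, ha.le⟩ ⟨b, hb.le⟩

/-- Monotone transport between two positive continuous probability densities on the line. -/
theorem exists_monotone_transport (hc : Continuous ρ) (hi : Integrable ρ) (hpos : ∀ x, 0 < ρ x)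
    (hm : ∫ t, ρ t = 1) (hc' : Continuous φ) (hi' : Integrable φ) (hpos' : ∀ x, 0 < φ x)
    (hm' : ∫ t, φ t = 1) :
    ∃ T : ℝ → ℝ, Function.Bijective T ∧ ∀ x, HasDerivAt T (ρ x / φ (T x)) x := by
  have hr := range_densityCDF hc hi hpos hm
  have hr' := range_densityCDF hc' hi' hpos' hm'
  have hmono := strictMono_densityCDF hc hi hpos
  have hmono' := strictMono_densityCDF hc' hi' hpos'
  let Q : ℝ → ℝ := Function.invFun (densityCDF φ)
  have hQ : ∀ c ∈ Ioo (0 : ℝ) 1, densityCDF φ (Q c) = c := fun c hcm =>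
    Function.invFun_eq (by rw [← hr'] at hcm; exact hcm)
  have hQ' : ∀ y, Q (densityCDF φ y) = y := Function.leftInverse_invFun hmono'.injective
  have hmem : ∀ x, densityCDF ρ x ∈ Ioo (0 : ℝ) 1 := fun x => hr ▸ mem_range_self x
  have hmem' : ∀ x, densityCDF φ x ∈ Ioo (0 : ℝ) 1 := fun x => hr' ▸ mem_range_self x
  have hQmono : StrictMonoOn Q (Ioo 0 1) := fun a ha b hb hab => by
    rw [← hmono'.lt_iff_lt, hQ a ha, hQ b hb]
    exact hab
  have hQimg : Q '' Ioo 0 1 = univ := eq_univ_of_forall fun y => ⟨_, hmem' y, hQ' y⟩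
  have hQder : ∀ c ∈ Ioo (0 : ℝ) 1, HasDerivAt Q (φ (Q c))⁻¹ c := fun c hcm => by
    have hnhds : Ioo (0 : ℝ) 1 ∈ 𝓝 c := isOpen_Ioo.mem_nhds hcm
    refine HasDerivAt.of_local_left_inverse
      (hQmono.continuousAt_of_image_mem_nhds hnhds (by rw [hQimg]; exact univ_mem))
      (hasDerivAt_densityCDF hc' hi' _) (hpos' _).ne' ?_
    filter_upwards [hnhds] with y hy using hQ y hy
  refine ⟨Q ∘ densityCDF ρ, ⟨fun a b hab => ?_, fun y => ?_⟩, fun x => ?_⟩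
  · exact hmono.injective (hQmono.injOn (hmem a) (hmem b) hab)
  · obtain ⟨x, hx⟩ : densityCDF φ y ∈ range (densityCDF ρ) := hr ▸ hmem' y
    exact ⟨x, by simp [hx, hQ']⟩
  · have := (hQder _ (hmem x)).comp x (hasDerivAt_densityCDF hc hi x)
    rwa [inv_mul_eq_div] at this

theorem integrable_sq_mul_gaussianPDFReal :
    Integrable (fun y : ℝ => y ^ 2 * ProbabilityTheory.gaussianPDFReal 0 1 y) ∧
      ∫ y : ℝ, y ^ 2 * ProbabilityTheory.gaussianPDFReal 0 1 y = 1 := by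
  have hv : ∫ x : ℝ, x ^ 2 ∂ProbabilityTheory.gaussianReal 0 1 = 1 := by
    have h := ProbabilityTheory.variance_fun_id_gaussianReal (μ := 0) (v := 1)
    rw [ProbabilityTheory.variance_eq_integral (by fun_prop)] at h
    simpa using h
  rw [ProbabilityTheory.integral_gaussianReal_eq_integral_smul one_ne_zero] at hv
  have he : (fun y : ℝ => y ^ 2 * ProbabilityTheory.gaussianPDFReal 0 1 y) =
      fun y => ProbabilityTheory.gaussianPDFReal 0 1 y • y ^ 2 := by
    ext y
    simp [mul_comm]
  rw [he]
  refine ⟨?_, hv⟩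
  by_contra h
  rw [integral_undef h] at hv
  exact zero_ne_one hv

/-- The Euclidean logarithmic Sobolev inequality on the line, for a normalized density `exp L`. -/
theorem integral_exp_mul_le_of_integral_eq_one {L : ℝ → ℝ} (hL : ContDiff ℝ 1 L)
    (hi : Integrable (fun x => Real.exp (L x))) (hm : ∫ x, Real.exp (L x) = 1)
    (hE : Integrable (fun x => Real.exp (L x) * L x))
    (hJ : Integrable (fun x => Real.exp (L x) * deriv L x ^ 2)) :
    ∫ x, Real.exp (L x) * L x ≤
      (1 / 2) * (∫ x, Real.exp (L x) * deriv L x ^ 2) - (1 + Real.log (2 * Real.pi) / 2) := by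
  set φ := ProbabilityTheory.gaussianPDFReal 0 1 with hφ
  have hφpos : ∀ y, 0 < φ y := fun y =>
    ProbabilityTheory.gaussianPDFReal_pos 0 1 y one_ne_zero
  have hφlog : ∀ y, Real.log (φ y) = -(Real.log (2 * Real.pi) / 2) - y ^ 2 / 2 := fun y => by
    rw [hφ, ProbabilityTheory.gaussianPDFReal, Real.log_mul (by positivity) (by positivity),
      Real.log_exp, Real.log_inv, Real.log_sqrt (by positivity)]
    simp
    ring
  have hφc : Continuous φ := by
    rw [hφ, ProbabilityTheory.gaussianPDFReal_def]
    fun_prop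
  have hLc : Continuous (fun x => Real.exp (L x)) := Real.continuous_exp.comp hL.continuous
  obtain ⟨T, hT, hTd⟩ := exists_monotone_transport hLc hi (fun x => Real.exp_pos _) hm hφc
    (ProbabilityTheory.integrable_gaussianPDFReal 0 1) hφpos
    (ProbabilityTheory.integral_gaussianPDFReal_eq_one 0 one_ne_zero)
  have hTc : Continuous T := continuous_iff_continuousAt.2 fun x => (hTd x).continuousAt
  set T' : ℝ → ℝ := fun x => Real.exp (L x) / φ (T x) with hT'
  have hT'c : Continuous T' := hLc.div (hφc.comp hTc) fun x => (hφpos _).ne'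
  have hT'pos : ∀ x, 0 < T' x := fun x => div_pos (Real.exp_pos _) (hφpos _)
  have hTC : ContDiff ℝ 1 T := contDiff_one_iff_deriv.2
    ⟨fun x => (hTd x).differentiableAt, by rwa [show deriv T = T' from funext fun x => (hTd x).deriv]⟩
  have hcv : (fun x => |T' x| • (T x ^ 2 * φ (T x))) = fun x => Real.exp (L x) * T x ^ 2 := by
    ext x
    rw [abs_of_pos (hT'pos x), smul_eq_mul, hT']
    field_simp [(hφpos (T x)).ne']
  have hTd' : ∀ x ∈ univ, HasDerivWithinAt T (T' x) univ x := fun x _ => (hTd x).hasDerivWithinAt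
  obtain ⟨g1, g2⟩ := integrable_sq_mul_gaussianPDFReal
  have i2 : Integrable (fun x => Real.exp (L x) * T x ^ 2) := by
    rw [← hcv, ← integrableOn_univ, ← integrableOn_image_iff_integrableOn_abs_deriv_smul
      MeasurableSet.univ hTd' hT.1.injOn (fun y => y ^ 2 * φ y), image_univ, hT.2.range_eq,
      integrableOn_univ]
    exact g1
  have e2 : ∫ x, Real.exp (L x) * T x ^ 2 = 1 := by
    rw [← hcv, ← setIntegral_univ, ← integral_image_eq_integral_abs_deriv_smul
      MeasurableSet.univ hTd' hT.1.injOn (fun y => y ^ 2 * φ y), image_univ, hT.2.range_eq,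
      setIntegral_univ]
    exact g2
  have hL' : Continuous (deriv L) := hL.continuous_deriv (by norm_num)
  have i1 : Integrable (fun x => Real.exp (L x) * T x) := by
    refine (hi.add i2).mono' (hLc.mul hTc).aestronglyMeasurable (ae_of_all _ fun x => ?_)
    have h := Real.exp_pos (L x)
    rw [norm_mul, Real.norm_of_nonneg h.le, Pi.add_apply, Real.norm_eq_abs]
    have : |T x| ≤ 1 + T x ^ 2 := abs_le.2 ⟨by nlinarith, by nlinarith⟩
    nlinarith
  have habs : ∀ x, |Real.exp (L x) * deriv L x * T x| ≤
      (1 / 2) * (Real.exp (L x) * deriv L x ^ 2) + (1 / 2) * (Real.exp (L x) * T x ^ 2) :=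
    fun x => by
      have h := Real.exp_pos (L x)
      rw [mul_assoc, abs_mul, abs_of_pos h]
      have : |deriv L x * T x| ≤ (deriv L x ^ 2 + T x ^ 2) / 2 :=
        abs_le.2 ⟨by nlinarith [sq_nonneg (deriv L x + T x)],
          by nlinarith [sq_nonneg (deriv L x - T x)]⟩
      nlinarith
  have ia : Integrable (fun x => Real.exp (L x) * deriv L x * T x) :=
    ((hJ.const_mul (1 / 2)).add (i2.const_mul (1 / 2))).mono'
      ((hLc.mul hL').mul hTc).aestronglyMeasurable (ae_of_all _ habs)
  obtain ⟨ib, eb⟩ := integrable_and_integral_eq_of_fderiv_eq_add (μ := volume)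
    (u := fun x => Real.exp (L x) * T x) (a := fun x => Real.exp (L x) * deriv L x * T x)
    (b := fun x => Real.exp (L x) * T' x) (1 : ℝ) (hL.exp.mul hTC) i1 (fun x => by
      rw [fderiv_apply_one_eq_deriv]
      exact (((hL.differentiable (by norm_num) x).hasDerivAt.exp).mul (hTd x)).deriv) ia
    (hLc.mul hT'c) (fun x => mul_nonneg (Real.exp_pos _).le (hT'pos x).le)
  have hle : -∫ x, Real.exp (L x) * deriv L x * T x ≤
      (1 / 2) * (∫ x, Real.exp (L x) * deriv L x ^ 2) + 1 / 2 := by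
    calc -∫ x, Real.exp (L x) * deriv L x * T x
        ≤ ∫ x, (1 / 2) * (Real.exp (L x) * deriv L x ^ 2) +
            (1 / 2) * (Real.exp (L x) * T x ^ 2) := by
          rw [← integral_neg]
          exact integral_mono ia.neg ((hJ.const_mul _).add (i2.const_mul _))
            fun x => (neg_le_abs _).trans (habs x)
      _ = _ := by
          rw [integral_add (hJ.const_mul _) (i2.const_mul _), integral_const_mul,
            integral_const_mul, e2, mul_one]
  set c := Real.log (2 * Real.pi) / 2
  calc ∫ x, Real.exp (L x) * L x
      ≤ ∫ x, Real.exp (L x) * T' x - (1 + c) * Real.exp (L x) -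
          (1 / 2) * (Real.exp (L x) * T x ^ 2) := by
        refine integral_mono hE ((ib.sub (hi.const_mul _)).sub (i2.const_mul _)) fun x => ?_
        have h1 : Real.log (T' x) = L x - Real.log (φ (T x)) := by
          rw [hT', Real.log_div (Real.exp_pos _).ne' (hφpos _).ne', Real.log_exp]
        have h2 := Real.log_le_sub_one_of_pos (hT'pos x)
        rw [h1, hφlog] at h2
        have := mul_le_mul_of_nonneg_left h2 (Real.exp_pos (L x)).le
        simp only
        linarith
    _ = -(∫ x, Real.exp (L x) * deriv L x * T x) - (1 + c) - 1 / 2 := by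
        have ibc : Integrable
            (fun x => Real.exp (L x) * T' x - (1 + c) * Real.exp (L x)) :=
          ib.sub (hi.const_mul _)
        rw [integral_sub ibc (i2.const_mul _),
          integral_sub ib (hi.const_mul _), integral_const_mul, integral_const_mul, e2, hm, eb]
        ring
    _ ≤ _ := by linarith

/-- The Euclidean logarithmic Sobolev inequality on the line. -/
theorem integral_exp_mul_sub_le {L : ℝ → ℝ} (hL : ContDiff ℝ 1 L)
    (hi : Integrable (fun x => Real.exp (L x)))
    (hE : Integrable (fun x => Real.exp (L x) * L x))
    (hJ : Integrable (fun x => Real.exp (L x) * deriv L x ^ 2)) :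
    (∫ x, Real.exp (L x) * L x) - (∫ x, Real.exp (L x)) * Real.log (∫ x, Real.exp (L x)) ≤
      (1 / 2) * (∫ x, Real.exp (L x) * deriv L x ^ 2) -
        (1 + Real.log (2 * Real.pi) / 2) * ∫ x, Real.exp (L x) := by
  set m := ∫ x, Real.exp (L x) with hm
  have hm0 : 0 < m := integral_exp_pos hi
  have hexp : ∀ x, Real.exp (L x - Real.log m) = m⁻¹ * Real.exp (L x) := fun x => by
    rw [Real.exp_sub, Real.exp_log hm0, div_eq_inv_mul]
  have hd : deriv (fun x => L x - Real.log m) = deriv L := by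
    ext x
    exact deriv_sub_const _
  have hEl : ∀ x, m⁻¹ * Real.exp (L x) * (L x - Real.log m) =
      m⁻¹ * (Real.exp (L x) * L x) - m⁻¹ * Real.log m * Real.exp (L x) := fun x => by ring
  have key := integral_exp_mul_le_of_integral_eq_one (L := fun x => L x - Real.log m)
    (hL.sub contDiff_const)
  simp only [hexp, hd, hEl, mul_assoc, integral_const_mul] at key
  rw [integral_sub (hE.const_mul _) ((hi.const_mul _).const_mul _)] at key
  simp only [integral_const_mul, ← hm] at key
  have h := key (hi.const_mul _) (inv_mul_cancel₀ hm0.ne')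
    ((hE.const_mul _).sub ((hi.const_mul _).const_mul _)) (hJ.const_mul _)
  have h' := mul_le_mul_of_nonneg_left h hm0.le
  field_simp at h' ⊢
  linarith

end OneDim

section Tensorization

open Filter

variable {α β : Type*} [MeasurableSpace α] [MeasurableSpace β] {μ : Measure α} {ν : Measure β}
  [SFinite μ] [SFinite ν] [NeZero ν] {L : α × β → ℝ}

theorem exists_integrable_le_mul_log_marginal (hL : Measurable L)
    (hi : Integrable (fun z => Real.exp (L z)) (μ.prod ν)) {p : α → ℝ} (hp : Measurable p)
    (hpe : Integrable (fun x => Real.exp (-p x)) μ)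
    (hpi : Integrable (fun z => Real.exp (L z) * p z.1) (μ.prod ν)) :
    ∃ lo : α × β → ℝ, Integrable lo (μ.prod ν) ∧
      ∀ᵐ z ∂μ.prod ν, lo z ≤ Real.exp (L z) * Real.log (∫ y, Real.exp (L (z.1, y)) ∂ν) := by
  set m : α → ℝ := fun x => ∫ y, Real.exp (L (x, y)) ∂ν with hm
  have hmm : Measurable m := (hL.exp.stronglyMeasurable.integral_prod_right').measurable
  have hpos : ∀ᵐ x ∂μ, 0 < m x := by
    filter_upwards [hi.prod_right_ae] with x hx using integral_exp_pos hx
  have hq : Integrable (fun z => Real.exp (-p z.1) * (Real.exp (L z) / m z.1)) (μ.prod ν) := by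
    have hmeas : Measurable fun z : α × β => Real.exp (-p z.1) * (Real.exp (L z) / m z.1) := by
      fun_prop
    refine (integrable_prod_iff hmeas.aestronglyMeasurable).2 ⟨?_, ?_⟩
    · filter_upwards [hi.prod_right_ae] with x hx using (hx.div_const _).const_mul _
    · refine hpe.congr ?_
      filter_upwards [hpos] with x hx
      have : ∀ y, ‖Real.exp (-p x) * (Real.exp (L (x, y)) / m x)‖ =
          Real.exp (-p x) * (Real.exp (L (x, y)) / m x) := fun y =>
        Real.norm_of_nonneg (by positivity)
      simp only [this]
      rw [integral_const_mul, integral_div, ← congrFun hm x, div_self hx.ne', mul_one]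
  refine ⟨_, (hi.sub hpi).sub hq, ?_⟩
  filter_upwards [Measure.quasiMeasurePreserving_fst.ae hpos] with z hz
  have h := Real.log_le_sub_one_of_pos (div_pos (Real.exp_pos (-p z.1)) hz)
  rw [Real.log_div (Real.exp_pos _).ne' hz.ne', Real.log_exp] at h
  have h' := mul_le_mul_of_nonneg_left h (Real.exp_pos (L z)).le
  have e : Real.exp (-p z.1) * (Real.exp (L z) / m z.1) =
    Real.exp (L z) * (Real.exp (-p z.1) / m z.1) := by ring
  simp only [Pi.sub_apply]
  rw [e]
  change _ ≤ Real.exp (L z) * Real.log (m z.1)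
  linarith

/-- Subadditivity of entropy on a product of two σ-finite measure spaces. -/
theorem entropy_subadditive [NeZero μ] (hL : Measurable L)
    (hi : Integrable (fun z => Real.exp (L z)) (μ.prod ν))
    (hE : Integrable (fun z => Real.exp (L z) * L z) (μ.prod ν))
    {p : α → ℝ} (hp : Measurable p) (hpe : Integrable (fun x => Real.exp (-p x)) μ)
    (hpi : Integrable (fun z => Real.exp (L z) * p z.1) (μ.prod ν))
    {q : β → ℝ} (hq : Measurable q) (hqe : Integrable (fun y => Real.exp (-q y)) ν)
    (hqi : Integrable (fun z => Real.exp (L z) * q z.2) (μ.prod ν)) :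
    Integrable (fun z => Real.exp (L z) * Real.log (∫ y, Real.exp (L (z.1, y)) ∂ν)) (μ.prod ν) ∧
    Integrable (fun z => Real.exp (L z) * Real.log (∫ x, Real.exp (L (x, z.2)) ∂μ)) (μ.prod ν) ∧
    (∫ z, Real.exp (L z) * Real.log (∫ y, Real.exp (L (z.1, y)) ∂ν) ∂μ.prod ν) +
      (∫ z, Real.exp (L z) * Real.log (∫ x, Real.exp (L (x, z.2)) ∂μ) ∂μ.prod ν) ≤
    (∫ z, Real.exp (L z) * L z ∂μ.prod ν) +
      (∫ z, Real.exp (L z) ∂μ.prod ν) * Real.log (∫ z, Real.exp (L z) ∂μ.prod ν) := by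
  obtain ⟨lo₁, hlo₁, hle₁⟩ := exists_integrable_le_mul_log_marginal hL hi hp hpe hpi
  obtain ⟨lo₂, hlo₂, hle₂⟩ := exists_integrable_le_mul_log_marginal (μ := ν) (ν := μ)
    (L := fun z => L z.swap) (hL.comp measurable_swap) hi.swap hq hqe hqi.swap
  replace hlo₂ := hlo₂.swap
  replace hle₂ := Measure.measurePreserving_swap (μ := μ) (ν := ν)
    |>.quasiMeasurePreserving.ae hle₂
  simp only [Prod.swap_swap, Prod.fst_swap, Prod.swap_prod_mk] at hle₂
  set m : α → ℝ := fun x => ∫ y, Real.exp (L (x, y)) ∂ν with hm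
  set r : β → ℝ := fun y => ∫ x, Real.exp (L (x, y)) ∂μ with hr
  set M := ∫ z, Real.exp (L z) ∂μ.prod ν with hM
  have : NeZero (μ.prod ν) := ⟨fun h => by
    have h' : μ Set.univ * ν Set.univ = 0 := by rw [← Measure.prod_prod, h]; simp
    simp [NeZero.ne] at h'⟩
  have hM0 : 0 < M := integral_exp_pos hi
  have hmm : Measurable m := (hL.exp.stronglyMeasurable.integral_prod_right').measurable
  have hrm : Measurable r := (hL.exp.stronglyMeasurable.integral_prod_left').measurable
  have hmpos : ∀ᵐ x ∂μ, 0 < m x := by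
    filter_upwards [hi.prod_right_ae] with x hx using integral_exp_pos hx
  have hrpos : ∀ᵐ y ∂ν, 0 < r y := by
    filter_upwards [hi.prod_left_ae] with y hy using integral_exp_pos hy
  have imr : Integrable (fun z : α × β => m z.1 * r z.2) (μ.prod ν) :=
    hi.integral_prod_left.mul_prod hi.integral_prod_right
  have emr : ∫ z : α × β, m z.1 * r z.2 ∂μ.prod ν = M * M := by
    rw [integral_prod_mul, hm, hr, ← integral_prod _ hi, ← integral_prod_symm _ hi]
  set up : α × β → ℝ := fun z => M⁻¹ * (m z.1 * r z.2) - Real.exp (L z) +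
    Real.exp (L z) * L z + Real.log M * Real.exp (L z) with hup
  have iup₀ : Integrable (fun z => M⁻¹ * (m z.1 * r z.2) - Real.exp (L z)) (μ.prod ν) :=
    (imr.const_mul _).sub hi
  have iup₁ : Integrable (fun z => M⁻¹ * (m z.1 * r z.2) - Real.exp (L z) +
    Real.exp (L z) * L z) (μ.prod ν) := iup₀.add hE
  have iup : Integrable up (μ.prod ν) := iup₁.add (hi.const_mul _)
  have eup : ∫ z, up z ∂μ.prod ν = (∫ z, Real.exp (L z) * L z ∂μ.prod ν) + M * Real.log M := by
    rw [hup, integral_add iup₁ (hi.const_mul _), integral_add iup₀ hE,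
      integral_sub (imr.const_mul _) hi, integral_const_mul, integral_const_mul, emr, ← hM]
    field_simp
    ring
  have hleup : ∀ᵐ z ∂μ.prod ν,
      Real.exp (L z) * Real.log (m z.1) + Real.exp (L z) * Real.log (r z.2) ≤ up z := by
    filter_upwards [Measure.quasiMeasurePreserving_fst.ae hmpos,
      Measure.quasiMeasurePreserving_snd.ae hrpos] with z h1 h2
    have hx := Real.exp_pos (L z)
    have h := Real.log_le_sub_one_of_pos (div_pos (mul_pos h1 h2) (mul_pos hM0 hx))
    rw [Real.log_div (mul_pos h1 h2).ne' (mul_pos hM0 hx).ne', Real.log_mul h1.ne' h2.ne',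
      Real.log_mul hM0.ne' hx.ne', Real.log_exp] at h
    have h' := mul_le_mul_of_nonneg_left h hx.le
    have e : Real.exp (L z) * (m z.1 * r z.2 / (M * Real.exp (L z)) - 1) =
        M⁻¹ * (m z.1 * r z.2) - Real.exp (L z) := by
      field_simp
    rw [e] at h'
    rw [hup]
    linarith
  have i1 : Integrable (fun z => Real.exp (L z) * Real.log (m z.1)) (μ.prod ν) := by
    refine integrable_of_le_of_le (Measurable.aestronglyMeasurable (by fun_prop)) hle₁ ?_ hlo₁
      (iup.sub hlo₂)
    filter_upwards [hleup, hle₂] with z h1 h2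
    simp only [Pi.sub_apply, Function.comp_apply] at h2 ⊢
    change lo₂ z.swap ≤ Real.exp (L z) * Real.log (r z.2) at h2
    linarith
  have i2 : Integrable (fun z => Real.exp (L z) * Real.log (r z.2)) (μ.prod ν) := by
    refine integrable_of_le_of_le (Measurable.aestronglyMeasurable (by fun_prop)) hle₂ ?_ hlo₂
      (iup.sub hlo₁)
    filter_upwards [hleup, hle₁] with z h1 h2
    simp only [Pi.sub_apply]
    linarith
  refine ⟨i1, i2, ?_⟩
  rw [← integral_add i1 i2, ← eup]
  exact integral_mono_ae (i1.add i2) iup hleup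

end Tensorization

section EuclideanLogSobolev

open Filter

/-- `y ↦ (0, y)` as a continuous linear map. -/
noncomputable def consZeroCLM (n : ℕ) : (Fin n → ℝ) →L[ℝ] (Fin (n + 1) → ℝ) :=
  LinearMap.toContinuousLinearMap
    { toFun := fun y => Fin.cons 0 y
      map_add' := fun y z => by
        ext i
        refine Fin.cases ?_ (fun j => ?_) i <;> simp
      map_smul' := fun c y => by
        ext i
        refine Fin.cases ?_ (fun j => ?_) i <;> simp }

theorem consZeroCLM_apply {n : ℕ} (y : Fin n → ℝ) : consZeroCLM n y = Fin.cons 0 y := rfl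

theorem cons_eq_smul_single_add {n : ℕ} (t : ℝ) (y : Fin n → ℝ) :
    (Fin.cons t y : Fin (n + 1) → ℝ) =
      t • Pi.single (M := fun _ => ℝ) 0 1 + consZeroCLM n y := by
  rw [consZeroCLM_apply]
  ext i
  refine Fin.cases ?_ (fun j => ?_) i <;> simp

theorem consZeroCLM_single {n : ℕ} (i : Fin n) :
    consZeroCLM n (Pi.single i 1) = Pi.single i.succ 1 := by
  rw [consZeroCLM_apply]
  ext j
  refine Fin.cases ?_ (fun k => ?_) j
  · simp
  · simp [Pi.single_apply]

theorem contDiff_cons {n : ℕ} :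
    ContDiff ℝ 1 (fun z : ℝ × (Fin n → ℝ) => (Fin.cons z.1 z.2 : Fin (n + 1) → ℝ)) := by
  simp_rw [cons_eq_smul_single_add]
  exact (contDiff_fst.smul contDiff_const).add ((consZeroCLM n).contDiff.comp contDiff_snd)

theorem fderiv_comp_cons_right {n : ℕ} {L : (Fin (n + 1) → ℝ) → ℝ} (hL : ContDiff ℝ 1 L) (t : ℝ)
    (y : Fin n → ℝ) (i : Fin n) :
    fderiv ℝ (fun y => L (Fin.cons t y)) y (Pi.single i 1) =
      fderiv ℝ L (Fin.cons t y) (Pi.single i.succ 1) := by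
  have h : HasFDerivAt (fun y : Fin n → ℝ => (Fin.cons t y : Fin (n + 1) → ℝ))
      (consZeroCLM n) y := by
    simp_rw [cons_eq_smul_single_add t]
    exact (consZeroCLM n).hasFDerivAt.const_add _
  have h' := ((hL.differentiable (by norm_num) _).hasFDerivAt.comp y h).fderiv
  change fderiv ℝ (L ∘ fun y : Fin n → ℝ => (Fin.cons t y : Fin (n + 1) → ℝ)) y _ = _
  rw [h', ContinuousLinearMap.comp_apply, consZeroCLM_single]

theorem deriv_comp_cons_left {n : ℕ} {L : (Fin (n + 1) → ℝ) → ℝ} (hL : ContDiff ℝ 1 L) (t : ℝ)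
    (y : Fin n → ℝ) :
    deriv (fun t => L (Fin.cons t y)) t = fderiv ℝ L (Fin.cons t y) (Pi.single 0 1) := by
  have h : HasDerivAt (fun t : ℝ => (Fin.cons t y : Fin (n + 1) → ℝ))
      (Pi.single (M := fun _ => ℝ) 0 1) t := by
    simp_rw [fun t => cons_eq_smul_single_add t y]
    simpa using ((hasDerivAt_id t).smul_const
      (Pi.single (M := fun _ : Fin (n + 1) => ℝ) 0 1)).add_const (consZeroCLM n y)
  exact ((hL.differentiable (by norm_num) _).hasFDerivAt.comp_hasDerivAt t h).deriv

theorem measurePreserving_cons (n : ℕ) :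
    MeasurePreserving (fun z : ℝ × (Fin n → ℝ) => (Fin.cons z.1 z.2 : Fin (n + 1) → ℝ)) ∧
    MeasurableEmbedding (fun z : ℝ × (Fin n → ℝ) => (Fin.cons z.1 z.2 : Fin (n + 1) → ℝ)) := by
  have h := (volume_preserving_piFinSuccAbove (fun _ : Fin (n + 1) => ℝ) 0).symm
  have e : (fun z : ℝ × (Fin n → ℝ) => (Fin.cons z.1 z.2 : Fin (n + 1) → ℝ)) =
      (MeasurableEquiv.piFinSuccAbove (fun _ : Fin (n + 1) => ℝ) 0).symm := by
    ext z : 1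
    simp [MeasurableEquiv.piFinSuccAbove, Fin.insertNthEquiv]
  rw [e]
  exact ⟨h, MeasurableEquiv.measurableEmbedding _⟩

theorem integrable_exp_neg_sum_sq (n : ℕ) :
    Integrable (fun y : Fin n → ℝ => Real.exp (-∑ i, y i ^ 2)) := by
  have h : Integrable (fun y : Fin n → ℝ => ∏ i, Real.exp (-(y i) ^ 2)) :=
    Integrable.fintype_prod (f := fun (_ : Fin n) (t : ℝ) => Real.exp (-t ^ 2))
      (fun _ => by simpa using integrable_exp_neg_mul_sq one_pos)
  refine h.congr (ae_of_all _ fun y => ?_)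
  simp only
  rw [← Real.exp_sum, Finset.sum_neg_distrib]

/-- The Euclidean logarithmic Sobolev inequality for a density `exp L` with finite second moment,
finite entropy and finite Fisher information. -/
theorem euclidean_logSobolev (n : ℕ) {L : (Fin n → ℝ) → ℝ} (hL : ContDiff ℝ 1 L)
    (hi : Integrable (fun x => Real.exp (L x)))
    (hE : Integrable (fun x => Real.exp (L x) * L x))
    (hJ : ∀ i, Integrable (fun x => Real.exp (L x) * fderiv ℝ L x (Pi.single i 1) ^ 2))
    (hV : Integrable (fun x => Real.exp (L x) * ∑ i, x i ^ 2)) :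
    (∫ x, Real.exp (L x) * L x) - (∫ x, Real.exp (L x)) * Real.log (∫ x, Real.exp (L x)) ≤
      (1 / 2) * (∑ i, ∫ x, Real.exp (L x) * fderiv ℝ L x (Pi.single i 1) ^ 2) -
        n * (1 + Real.log (2 * Real.pi) / 2) * ∫ x, Real.exp (L x) := by
  induction n with
  | zero =>
    rw [Measure.volume_pi_eq_dirac (0 : Fin 0 → ℝ)]
    simp
  | succ n ih =>
    obtain ⟨mp, me⟩ := measurePreserving_cons n
    set c := 1 + Real.log (2 * Real.pi) / 2
    let S : ℝ × (Fin n → ℝ) → (Fin (n + 1) → ℝ) := fun z => Fin.cons z.1 z.2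
    have tr : ∀ {w : (Fin (n + 1) → ℝ) → ℝ}, Integrable w →
        Integrable (fun z => w (S z)) (volume.prod volume) := fun {w} hw =>
      (mp.integrable_comp_emb me).2 hw
    have ti : ∀ w : (Fin (n + 1) → ℝ) → ℝ, ∫ x, w x = ∫ z, w (S z) ∂(volume.prod volume) :=
      fun w => (mp.integral_comp me w).symm
    have hSc : Continuous S := contDiff_cons.continuous
    have hKc : Continuous (fun z => L (S z)) := hL.continuous.comp hSc
    have i0 := tr hi
    have iE := tr hE
    have iJ := fun i => tr (hJ i)
    have iV := tr hV
    have hVs : ∀ z, ∑ i, S z i ^ 2 = z.1 ^ 2 + ∑ i, z.2 i ^ 2 := fun z => by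
      simp [S, Fin.sum_univ_succ]
    have iV1 : Integrable (fun z => Real.exp (L (S z)) * z.1 ^ 2) (volume.prod volume) := by
      refine iV.mono' (Continuous.aestronglyMeasurable (by fun_prop)) (ae_of_all _ fun z => ?_)
      rw [Real.norm_of_nonneg (by positivity), hVs]
      gcongr
      exact le_add_of_nonneg_right (by positivity)
    have iV2 : Integrable (fun z => Real.exp (L (S z)) * ∑ i, z.2 i ^ 2)
        (volume.prod volume) := by
      refine iV.mono' (Continuous.aestronglyMeasurable (by fun_prop)) (ae_of_all _ fun z => ?_)
      rw [Real.norm_of_nonneg (by positivity), hVs]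
      gcongr
      exact le_add_of_nonneg_left (by positivity)
    obtain ⟨im, ir, hsub⟩ := entropy_subadditive (μ := (volume : Measure ℝ))
      (ν := (volume : Measure (Fin n → ℝ))) (L := fun z => L (S z)) hKc.measurable i0 iE
      (p := fun t => t ^ 2) (by fun_prop) (by simpa using integrable_exp_neg_mul_sq one_pos) iV1
      (q := fun y => ∑ i, y i ^ 2) (by fun_prop) (integrable_exp_neg_sum_sq n) iV2
    have h1 : ∫ z, (Real.exp (L (S z)) * L (S z) -
          Real.exp (L (S z)) * Real.log (∫ y, Real.exp (L (S (z.1, y)))))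
          ∂((volume : Measure ℝ).prod volume) ≤
        ∫ z, ((1 / 2) * (∑ i : Fin n, Real.exp (L (S z)) *
            fderiv ℝ L (S z) (Pi.single i.succ 1) ^ 2) - n * c * Real.exp (L (S z)))
          ∂((volume : Measure ℝ).prod volume) := by
      have ia : Integrable (fun z => Real.exp (L (S z)) * L (S z) -
          Real.exp (L (S z)) * Real.log (∫ y, Real.exp (L (S (z.1, y)))))
          ((volume : Measure ℝ).prod volume) := iE.sub im
      have ib : Integrable (fun z => (1 / 2) * (∑ i : Fin n, Real.exp (L (S z)) *
            fderiv ℝ L (S z) (Pi.single i.succ 1) ^ 2) - n * c * Real.exp (L (S z)))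
          ((volume : Measure ℝ).prod volume) :=
        ((integrable_finsetSum _ fun i _ => iJ i.succ).const_mul _).sub (i0.const_mul _)
      rw [integral_prod _ ia, integral_prod _ ib]
      refine integral_mono_ae ia.integral_prod_left ib.integral_prod_left ?_
      filter_upwards [i0.prod_right_ae, iE.prod_right_ae, iV2.prod_right_ae,
        ae_all_iff.2 fun i : Fin n => (iJ i.succ).prod_right_ae] with t a1 a2 a3 a4
      have hIH := ih (L := fun y => L (S (t, y)))
        (hL.comp (contDiff_cons.comp (contDiff_const.prodMk contDiff_id))) a1 a2
        (fun i => by simpa only [S, fderiv_comp_cons_right hL] using a4 i) a3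
      simp only [S, fderiv_comp_cons_right hL] at hIH a1 a2 a4 ⊢
      rw [integral_sub a2 (a1.mul_const _), integral_mul_const,
        integral_sub ((integrable_finsetSum _ fun i _ => a4 i).const_mul _) (a1.const_mul _),
        integral_const_mul, integral_const_mul, integral_finsetSum _ fun i _ => a4 i]
      exact hIH
    have h2 : ∫ z, (Real.exp (L (S z)) * L (S z) -
          Real.exp (L (S z)) * Real.log (∫ t, Real.exp (L (S (t, z.2)))))
          ∂((volume : Measure ℝ).prod volume) ≤
        ∫ z, ((1 / 2) * (Real.exp (L (S z)) *
            fderiv ℝ L (S z) (Pi.single 0 1) ^ 2) - c * Real.exp (L (S z)))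
          ∂((volume : Measure ℝ).prod volume) := by
      have ia : Integrable (fun z => Real.exp (L (S z)) * L (S z) -
          Real.exp (L (S z)) * Real.log (∫ t, Real.exp (L (S (t, z.2)))))
          ((volume : Measure ℝ).prod volume) := iE.sub ir
      have ib : Integrable (fun z => (1 / 2) * (Real.exp (L (S z)) *
            fderiv ℝ L (S z) (Pi.single 0 1) ^ 2) - c * Real.exp (L (S z)))
          ((volume : Measure ℝ).prod volume) := ((iJ 0).const_mul (1 / 2)).sub (i0.const_mul c)
      rw [integral_prod_symm _ ia, integral_prod_symm _ ib]
      refine integral_mono_ae ia.integral_prod_right ib.integral_prod_right ?_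
      filter_upwards [i0.prod_left_ae, iE.prod_left_ae, (iJ 0).prod_left_ae] with y a1 a2 a3
      have h := integral_exp_mul_sub_le (L := fun t => L (S (t, y)))
        (hL.comp (contDiff_cons.comp (contDiff_id.prodMk contDiff_const))) a1 a2
        (by simpa only [S, deriv_comp_cons_left hL] using a3)
      simp only [S, deriv_comp_cons_left hL] at h a1 a2 a3 ⊢
      rw [integral_sub a2 (a1.mul_const _), integral_mul_const,
        integral_sub (a3.const_mul _) (a1.const_mul _), integral_const_mul, integral_const_mul]
      exact h
    rw [integral_sub iE im, integral_sub ((integrable_finsetSum _ fun i _ =>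
      iJ i.succ).const_mul _) (i0.const_mul _), integral_const_mul, integral_const_mul,
      integral_finsetSum _ fun i _ => iJ i.succ] at h1
    rw [integral_sub iE ir, integral_sub ((iJ 0).const_mul _) (i0.const_mul _),
      integral_const_mul, integral_const_mul] at h2
    rw [ti (fun x => Real.exp (L x) * L x), ti (fun x => Real.exp (L x)), Fin.sum_univ_succ,
      ti (fun x => Real.exp (L x) * fderiv ℝ L x (Pi.single 0 1) ^ 2)]
    simp only [fun i : Fin n => ti (fun x => Real.exp (L x) *
      fderiv ℝ L x (Pi.single i.succ 1) ^ 2)]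
    push_cast
    linarith

end EuclideanLogSobolev

section IntrinsicLogSobolev

/-- Integration by parts for the directional Fisher information of the density `exp L`. -/
theorem integrable_and_integral_exp_mul_fderiv_sq {E : Type*} [NormedAddCommGroup E]
    [NormedSpace ℝ E] [FiniteDimensional ℝ E] [MeasurableSpace E] [BorelSpace E] {μ : Measure E}
    [μ.IsAddHaarMeasure] {L : E → ℝ} (hL : ContDiff ℝ 2 L) (v : E)
    (hi : Integrable (fun x => Real.exp (L x)) μ)
    (hd : Integrable (fun x => Real.exp (L x) * fderiv ℝ (fun y => fderiv ℝ L y v) x v) μ) :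
    Integrable (fun x => Real.exp (L x) * fderiv ℝ L x v ^ 2) μ ∧
      ∫ x, Real.exp (L x) * fderiv ℝ L x v ^ 2 ∂μ =
        -∫ x, Real.exp (L x) * fderiv ℝ (fun y => fderiv ℝ L y v) x v ∂μ := by
  have hL1 : ContDiff ℝ 1 (fun y => fderiv ℝ L y v) :=
    (hL.fderiv_right (m := 1) (by norm_num)).clm_apply contDiff_const
  have hLd : Differentiable ℝ L := hL.differentiable (by norm_num)
  have h1 : (fun y => fderiv ℝ (fun x => Real.exp (L x)) y v) =
      fun y => Real.exp (L y) * fderiv ℝ L y v := by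
    ext y
    rw [(hLd y).hasFDerivAt.exp.fderiv]
    simp
  refine integrable_and_integral_eq_of_fderiv_fderiv_eq_add v hL.exp hi (fun x => ?_) hd
    (hL.continuous.rexp.mul (hL1.continuous.pow 2)) fun x => by positivity
  rw [h1, ((hLd x).hasFDerivAt.exp.fun_mul
    (hL1.differentiable (by norm_num) x).hasFDerivAt).fderiv]
  simp
  ring

variable {n : ℕ}

theorem integrable_and_integral_comp_mulVec {B : Matrix (Fin n) (Fin n) ℝ} (hB : B.det ≠ 0)
    {F : (Fin n → ℝ) → ℝ} (hF : Integrable F) :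
    Integrable (fun w => F (B.mulVec w)) ∧
      ∫ w, F (B.mulVec w) = |B.det|⁻¹ * ∫ x, F x := by
  have hm := Real.map_matrix_volume_pi_eq_smul_volume_pi hB
  have hA : AEMeasurable (Matrix.toLin' B) (volume : Measure (Fin n → ℝ)) :=
    (LinearMap.continuous_of_finiteDimensional (Matrix.toLin' B)).measurable.aemeasurable
  have hF' : Integrable F (Measure.map (Matrix.toLin' B) volume) := by
    rw [hm]
    exact hF.smul_measure ENNReal.ofReal_ne_top
  refine ⟨(integrable_map_measure hF'.1 hA).1 hF', ?_⟩
  have h := integral_map hA hF'.1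
  rw [hm, integral_smul_measure, ENNReal.toReal_ofReal (abs_nonneg _), abs_inv, smul_eq_mul] at h
  simpa using h.symm

/-- The Euclidean logarithmic Sobolev inequality after an invertible linear change of variables. -/
theorem logSobolev_comp_mulVec {L : (Fin n → ℝ) → ℝ} (hL : ContDiff ℝ 1 L)
    (hi : Integrable (fun x => Real.exp (L x))) (h1 : ∫ x, Real.exp (L x) = 1)
    (hE : Integrable (fun x => Real.exp (L x) * L x))
    (hJ : ∀ v, Integrable (fun x => Real.exp (L x) * fderiv ℝ L x v ^ 2))
    (hV : Integrable (fun x => Real.exp (L x) * ∑ i, x i ^ 2))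
    {B : Matrix (Fin n) (Fin n) ℝ} (hB : B.det ≠ 0) :
    (∫ x, Real.exp (L x) * L x) + Real.log |B.det| ≤
      (1 / 2) * (∑ i, ∫ x, Real.exp (L x) * fderiv ℝ L x (B.mulVec (Pi.single i 1)) ^ 2) -
        n * (1 + Real.log (2 * Real.pi) / 2) := by
  have hd : 0 < |B.det| := abs_pos.2 hB
  have hdL : ∀ w v, fderiv ℝ (fun w => L (B.mulVec w)) w v =
      fderiv ℝ L (B.mulVec w) (B.mulVec v) := fun w v => by
    have h := ((hL.differentiable (by norm_num) (B.mulVec w)).hasFDerivAt).comp w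
      (LinearMap.toContinuousLinearMap (Matrix.toLin' B)).hasFDerivAt
    exact congrArg (fun A => A v) h.fderiv
  have hV' : Integrable (fun w => Real.exp (L (B.mulVec w)) * ∑ i, w i ^ 2) := by
    have hc : Continuous (fun x : Fin n → ℝ => ∑ i, (B⁻¹.mulVec x) i ^ 2) :=
      continuous_finsetSum _ fun i _ =>
        ((continuous_apply i).comp (continuous_const.matrix_mulVec continuous_id)).pow 2
    have hF : Integrable (fun x => Real.exp (L x) * ∑ i, (B⁻¹.mulVec x) i ^ 2) := by
      refine (hV.const_mul (∑ i, ∑ j, B⁻¹ i j ^ 2)).mono'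
        (hL.continuous.rexp.mul hc).aestronglyMeasurable (ae_of_all _ fun x => ?_)
      rw [Real.norm_of_nonneg (by positivity), mul_left_comm, Finset.sum_mul]
      refine mul_le_mul_of_nonneg_left (Finset.sum_le_sum fun i _ => ?_) (Real.exp_nonneg _)
      exact Finset.sum_mul_sq_le_sq_mul_sq Finset.univ (fun j => B⁻¹ i j) x
    simpa [Matrix.mulVec_mulVec, Matrix.nonsing_inv_mul B (isUnit_iff_ne_zero.2 hB)] using
      (integrable_and_integral_comp_mulVec hB hF).1
  have hLB : ContDiff ℝ 1 (fun w => L (B.mulVec w)) :=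
    hL.comp (LinearMap.toContinuousLinearMap (Matrix.toLin' B)).contDiff
  have key := euclidean_logSobolev n hLB (integrable_and_integral_comp_mulVec hB hi).1
    (integrable_and_integral_comp_mulVec hB hE).1
    (fun i => by
      simpa only [hdL] using (integrable_and_integral_comp_mulVec hB (hJ _)).1) hV'
  have e : ∀ i, ∫ w, Real.exp (L (B.mulVec w)) *
      fderiv ℝ L (B.mulVec w) (B.mulVec (Pi.single i 1)) ^ 2 =
      |B.det|⁻¹ * ∫ x, Real.exp (L x) * fderiv ℝ L x (B.mulVec (Pi.single i 1)) ^ 2 := fun i =>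
    (integrable_and_integral_comp_mulVec hB (hJ _)).2
  simp only [hdL, e] at key
  rw [(integrable_and_integral_comp_mulVec hB hE).2,
    (integrable_and_integral_comp_mulVec hB hi).2, h1, mul_one, Real.log_inv,
    ← Finset.mul_sum] at key
  refine le_of_mul_le_mul_left ?_ (inv_pos.2 hd)
  linarith

/-- Optimising a trace inequality over all invertible changes of variables. -/
theorem le_half_log_det_of_forall_le_trace {J : Matrix (Fin n) (Fin n) ℝ} (hJ : J.IsHermitian)
    {S K : ℝ} (h : ∀ B : Matrix (Fin n) (Fin n) ℝ, B.det ≠ 0 →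
      S + Real.log |B.det| ≤ (1 / 2) * (B.transpose * J * B).trace - K) :
    S ≤ (1 / 2) * Real.log J.det + n / 2 - K := by
  set U : Matrix (Fin n) (Fin n) ℝ := (hJ.eigenvectorUnitary : Matrix (Fin n) (Fin n) ℝ) with hU
  have hUU : U.transpose * U = 1 := by
    have := (Matrix.mem_unitaryGroup_iff'.1 hJ.eigenvectorUnitary.2)
    simpa [Matrix.star_eq_conjTranspose] using this
  have hdU : |U.det| = 1 := by
    have := congrArg Matrix.det hUU
    rw [Matrix.det_mul, Matrix.det_transpose, Matrix.det_one] at this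
    exact (sq_eq_sq₀ (abs_nonneg _) zero_le_one).1 (by rw [sq_abs, sq, this, one_pow])
  have hD : U.transpose * J * U = Matrix.diagonal hJ.eigenvalues := by
    have h1 := hJ.spectral_theorem
    rw [Unitary.conjStarAlgAut_apply] at h1
    have h2 : J = U * Matrix.diagonal hJ.eigenvalues * U.transpose := by
      simpa [Matrix.star_eq_conjTranspose, Function.comp_def] using h1
    conv_lhs => rw [h2]
    rw [← Matrix.mul_assoc, ← Matrix.mul_assoc, hUU, Matrix.one_mul, Matrix.mul_assoc, hUU,
      Matrix.mul_one]
  have hdiag : ∀ b : Fin n → ℝ, (∀ i, 0 < b i) →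
      S + ∑ i, Real.log (b i) ≤ (1 / 2) * ∑ i, b i ^ 2 * hJ.eigenvalues i - K := by
    intro b hb
    have hdet : |(U * Matrix.diagonal b).det| = ∏ i, b i := by
      rw [Matrix.det_mul, abs_mul, hdU, one_mul, Matrix.det_diagonal,
        abs_of_pos (Finset.prod_pos fun i _ => hb i)]
    have hpos : 0 < ∏ i, b i := Finset.prod_pos fun i _ => hb i
    have h3 := h (U * Matrix.diagonal b) (abs_pos.1 (hdet ▸ hpos))
    rw [hdet, Real.log_prod fun i _ => (hb i).ne'] at h3
    refine h3.trans_eq ?_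
    have : (U * Matrix.diagonal b).transpose * J * (U * Matrix.diagonal b) =
        Matrix.diagonal b * (U.transpose * J * U) * Matrix.diagonal b := by
      simp [Matrix.transpose_mul, Matrix.mul_assoc]
    rw [this, hD, Matrix.diagonal_mul_diagonal, Matrix.diagonal_mul_diagonal,
      Matrix.trace_diagonal]
    congr 2
    exact Finset.sum_congr rfl fun i _ => by ring
  have hev : ∀ j, 0 < hJ.eigenvalues j := by
    intro j
    by_contra! hj
    set R := (1 / 2) * ∑ i, |hJ.eigenvalues i| - K - S with hR
    have h4 := hdiag (Function.update 1 j (Real.exp (R + 1))) fun i => by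
      rcases eq_or_ne i j with rfl | hij
      · simpa using Real.exp_pos _
      · simp [hij]
    have h5 : ∑ i, Real.log (Function.update (1 : Fin n → ℝ) j (Real.exp (R + 1)) i) = R + 1 := by
      rw [Finset.sum_eq_single j]
      · simp
      · intro i _ hij
        simp [hij]
      · simp
    have h6 : ∑ i, Function.update (1 : Fin n → ℝ) j (Real.exp (R + 1)) i ^ 2 * hJ.eigenvalues i ≤
        ∑ i, |hJ.eigenvalues i| := by
      refine Finset.sum_le_sum fun i _ => ?_
      rcases eq_or_ne i j with rfl | hij
      · exact (mul_nonpos_of_nonneg_of_nonpos (sq_nonneg _) hj).trans (abs_nonneg _)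
      · simpa [hij] using le_abs_self _
    linarith
  have h7 := hdiag (fun i => (Real.sqrt (hJ.eigenvalues i))⁻¹) fun i =>
    inv_pos.2 (Real.sqrt_pos.2 (hev i))
  have h8 : ∑ i, (Real.sqrt (hJ.eigenvalues i))⁻¹ ^ 2 * hJ.eigenvalues i = n := by
    rw [Finset.sum_congr rfl fun i _ => show _ = (1 : ℝ) by
      rw [inv_pow, Real.sq_sqrt (hev i).le, inv_mul_cancel₀ (hev i).ne']]
    simp
  have h9 : Real.log J.det = ∑ i, Real.log (hJ.eigenvalues i) := by
    rw [hJ.det_eq_prod_eigenvalues, ← Real.log_prod fun i _ => (hev i).ne']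
    simp
  have h10 : ∑ i, Real.log (Real.sqrt (hJ.eigenvalues i))⁻¹ = -((1 / 2) * Real.log J.det) := by
    rw [h9, Finset.mul_sum, ← Finset.sum_neg_distrib]
    refine Finset.sum_congr rfl fun i _ => ?_
    rw [Real.log_inv, Real.log_sqrt (hev i).le]
    ring
  rw [h8, h10] at h7
  linarith

/-- The intrinsic dimensional logarithmic Sobolev inequality for a probability density `exp L` with
respect to Lebesgue measure. -/
theorem integral_exp_mul_le_log_det {L : (Fin n → ℝ) → ℝ} (hL : ContDiff ℝ 2 L)
    (hi : Integrable (fun x => Real.exp (L x))) (h1 : ∫ x, Real.exp (L x) = 1)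
    (hE : Integrable (fun x => Real.exp (L x) * L x))
    (hV : Integrable (fun x => Real.exp (L x) * ∑ i, x i ^ 2))
    {J : Matrix (Fin n) (Fin n) ℝ} (hJ : J.IsHermitian)
    (hd : ∀ v, Integrable (fun x => Real.exp (L x) * fderiv ℝ (fun y => fderiv ℝ L y v) x v))
    (hdJ : ∀ v, ∫ x, Real.exp (L x) * fderiv ℝ (fun y => fderiv ℝ L y v) x v =
      -(v ⬝ᵥ J.mulVec v)) :
    ∫ x, Real.exp (L x) * L x ≤
      (1 / 2) * Real.log J.det - n / 2 - n * (Real.log (2 * Real.pi) / 2) := by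
  have hF := fun v => integrable_and_integral_exp_mul_fderiv_sq hL v hi (hd v)
  have h := le_half_log_det_of_forall_le_trace hJ (S := ∫ x, Real.exp (L x) * L x)
    (K := n * (1 + Real.log (2 * Real.pi) / 2)) fun B hB => by
      refine (logSobolev_comp_mulVec (hL.of_le (by norm_num)) hi h1 hE (fun v => (hF v).1) hV
        hB).trans_eq ?_
      simp only [(hF _).2, hdJ, neg_neg, Matrix.trace, Matrix.diag]
      congr 2
      refine Finset.sum_congr rfl fun i _ => ?_
      have : (B.transpose * J * B) i i =
          Pi.single i 1 ⬝ᵥ (B.transpose * J * B).mulVec (Pi.single i 1) := by simp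
      rw [this, ← Matrix.mulVec_mulVec, ← Matrix.mulVec_mulVec,
        Matrix.dotProduct_mulVec (Pi.single i 1), Matrix.vecMul_transpose]
  linarith

end IntrinsicLogSobolev

section HeatSemigroup

/-- The density of the standard Gaussian measure. -/
noncomputable def gaussDensity {n : ℕ} (z : Fin n → ℝ) : ℝ :=
  (2 * Real.pi) ^ (-(n : ℝ) / 2) * Real.exp (-(∑ i, z i ^ 2) / 2)

theorem integrable_withDensity_ofReal_iff {α : Type*} [MeasurableSpace α] {μ : Measure α}
    {ρ w : α → ℝ} (hρ : Measurable ρ) (h0 : ∀ x, 0 ≤ ρ x) :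
    Integrable w (μ.withDensity fun x => ENNReal.ofReal (ρ x)) ↔
      Integrable (fun x => ρ x * w x) μ := by
  rw [integrable_withDensity_iff_integrable_smul' hρ.ennreal_ofReal
    (ae_of_all _ fun _ => ENNReal.ofReal_lt_top)]
  simp only [ENNReal.toReal_ofReal (h0 _), smul_eq_mul]

theorem integral_withDensity_ofReal {α : Type*} [MeasurableSpace α] {μ : Measure α}
    {ρ : α → ℝ} (hρ : Measurable ρ) (h0 : ∀ x, 0 ≤ ρ x) (w : α → ℝ) :
    ∫ x, w x ∂(μ.withDensity fun x => ENNReal.ofReal (ρ x)) = ∫ x, ρ x * w x ∂μ := by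
  rw [integral_withDensity_eq_integral_toReal_smul hρ.ennreal_ofReal
    (ae_of_all _ fun _ => ENNReal.ofReal_lt_top)]
  simp only [ENNReal.toReal_ofReal (h0 _), smul_eq_mul]

variable {n : ℕ}

theorem continuous_gaussDensity : Continuous (gaussDensity : (Fin n → ℝ) → ℝ) := by
  unfold gaussDensity
  fun_prop

theorem gaussDensity_pos (z : Fin n → ℝ) : 0 < gaussDensity z := by
  unfold gaussDensity
  positivity

theorem gaussDensity_sub_single (z : Fin n → ℝ) (i : Fin n) (s : ℝ) :
    gaussDensity (z - Pi.single i s) =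
      Real.exp (-(s ^ 2) / 2) * (gaussDensity z * Real.exp (s * z i)) := by
  have h : ∑ j, (z - Pi.single i s : Fin n → ℝ) j ^ 2 = (∑ j, z j ^ 2) - 2 * s * z i + s ^ 2 := by
    rw [← Finset.add_sum_erase _ _ (Finset.mem_univ i),
      ← Finset.add_sum_erase _ (fun j => z j ^ 2) (Finset.mem_univ i),
      Finset.sum_congr rfl fun j hj => show (z - Pi.single i s : Fin n → ℝ) j ^ 2 = z j ^ 2 by
        simp [Finset.ne_of_mem_erase hj]]
    simp
    ring
  unfold gaussDensity
  rw [h, mul_left_comm, mul_assoc, mul_assoc, mul_left_comm (Real.exp _), ← Real.exp_add,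
    ← Real.exp_add]
  ring_nf

theorem exp_log_sub_eq_mul_gaussDensity {r : ℝ} (hr : 0 < r) (z : Fin n → ℝ) :
    Real.exp (Real.log r - (∑ i, z i ^ 2) / 2 - n * (Real.log (2 * Real.pi) / 2)) =
      gaussDensity z * r := by
  rw [gaussDensity, Real.rpow_def_of_pos (by positivity), ← Real.exp_add]
  conv_rhs => rw [← Real.exp_log hr, ← Real.exp_add]
  ring_nf

theorem integrable_stdGauss_iff {w : (Fin n → ℝ) → ℝ} :
    Integrable w (stdGauss n) ↔ Integrable (fun z => gaussDensity z * w z) :=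
  integrable_withDensity_ofReal_iff continuous_gaussDensity.measurable
    fun z => (gaussDensity_pos z).le

theorem heatSG_eq_integral_gaussDensity (t : ℝ) (h : (Fin n → ℝ) → ℝ) (y : Fin n → ℝ) :
    heatSG t h y = ∫ z, gaussDensity z * h (y + Real.sqrt t • z) :=
  integral_withDensity_ofReal continuous_gaussDensity.measurable
    (fun z => (gaussDensity_pos z).le) _

variable {T : ℝ} {f : (Fin n → ℝ) → ℝ} {x : Fin n → ℝ}

/-- Shifting the base point of the heat semigroup tilts the Gaussian weight exponentially. -/
theorem heatSG_add_single
    (hint0 : ∀ y : Fin n → ℝ, Integrable (fun z => f (y + Real.sqrt T • z)) (stdGauss n))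
    (i : Fin n) (s : ℝ) :
    Integrable (fun z => gaussDensity z * f (x + Real.sqrt T • z) * Real.exp (s * z i)) ∧
      heatSG T f (x + s • Real.sqrt T • Pi.single i 1) = Real.exp (-(s ^ 2) / 2) *
        ∫ z, gaussDensity z * f (x + Real.sqrt T • z) * Real.exp (s * z i) := by
  have e : ∀ z : Fin n → ℝ, gaussDensity (z - Pi.single i s) *
      f (x + s • Real.sqrt T • Pi.single i 1 + Real.sqrt T • (z - Pi.single i s)) =
      Real.exp (-(s ^ 2) / 2) *
        (gaussDensity z * f (x + Real.sqrt T • z) * Real.exp (s * z i)) := fun z => by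
    have : x + s • Real.sqrt T • Pi.single i 1 + Real.sqrt T • (z - Pi.single i s) =
        x + Real.sqrt T • z := by
      have h1 : (Pi.single i s : Fin n → ℝ) = s • Pi.single i 1 := by
        rw [← Pi.single_smul, smul_eq_mul, mul_one]
      rw [h1, smul_sub, smul_comm s]
      abel
    rw [this, gaussDensity_sub_single]
    ring
  have h1 := (integrable_stdGauss_iff.1 (hint0 (x + s • Real.sqrt T • Pi.single i 1))).comp_sub_right
    (Pi.single i s)
  simp only [e] at h1
  refine ⟨?_, ?_⟩
  · refine (h1.const_mul (Real.exp (-(s ^ 2) / 2))⁻¹).congr (ae_of_all _ fun z => ?_)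
    exact inv_mul_cancel_left₀ (Real.exp_ne_zero _) _
  · rw [heatSG_eq_integral_gaussDensity, ← integral_const_mul]
    simp only [← e]
    exact (integral_sub_right_eq_self (fun z => gaussDensity z *
      f (x + s • Real.sqrt T • Pi.single i 1 + Real.sqrt T • z)) (Pi.single i s)).symm

/-- The second moments of the tilted Gaussian measure in terms of the second derivatives of the
heat semigroup. -/
theorem integral_gaussDensity_mul_sq (hT : 0 < T) (hf : Continuous f) (hfpos : ∀ y, 0 < f y)
    (hreg : ContDiff ℝ 2 (heatSG T f : (Fin n → ℝ) → ℝ))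
    (hint0 : ∀ y : Fin n → ℝ, Integrable (fun z => f (y + Real.sqrt T • z)) (stdGauss n))
    (i : Fin n) :
    Integrable (fun z => gaussDensity z * f (x + Real.sqrt T • z) * z i ^ 2) ∧
      ∫ z, gaussDensity z * f (x + Real.sqrt T • z) * z i ^ 2 =
        heatSG T f x + T * pderiv' (fun y => pderiv' (heatSG T f) i y) i x := by
  set ρ : (Fin n → ℝ) → ℝ := fun z => gaussDensity z * f (x + Real.sqrt T • z) with hρ
  have hρm : Measurable ρ := (continuous_gaussDensity.mul (by fun_prop)).measurable
  have hρ0 : ∀ z, 0 ≤ ρ z := fun z => (mul_pos (gaussDensity_pos z) (hfpos _)).le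
  set μ : Measure (Fin n → ℝ) := volume.withDensity fun z => ENNReal.ofReal (ρ z)
  have hset : ∀ s, s ∈ interior (ProbabilityTheory.integrableExpSet (fun z => z i) μ) := by
    have : ProbabilityTheory.integrableExpSet (fun z => z i) μ = Set.univ :=
      Set.eq_univ_of_forall fun s => (integrable_withDensity_ofReal_iff hρm hρ0).2
        (heatSG_add_single hint0 i s).1
    simp [this]
  have hI : ∀ k s, ∫ z, z i ^ k * Real.exp (s * z i) ∂μ =
      ∫ z, ρ z * (z i ^ k * Real.exp (s * z i)) := fun k s =>
    integral_withDensity_ofReal hρm hρ0 _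
  have hder : ∀ k s, HasDerivAt (fun s => ∫ z, ρ z * (z i ^ k * Real.exp (s * z i)))
      (∫ z, ρ z * (z i ^ (k + 1) * Real.exp (s * z i))) s := fun k s => by
    have := ProbabilityTheory.hasDerivAt_integral_pow_mul_exp_real (hset s) k
    simpa only [hI] using this
  refine ⟨(integrable_withDensity_ofReal_iff hρm hρ0).1
    (ProbabilityTheory.integrable_pow_of_mem_interior_integrableExpSet (hset 0) 2), ?_⟩
  set e : Fin n → ℝ := Real.sqrt T • Pi.single i 1 with he
  have hline : ∀ s : ℝ, HasDerivAt (fun s : ℝ => x + s • e) e s := fun s => by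
    simpa using ((hasDerivAt_id s).smul_const e).const_add x
  have hG1 : ∀ s, HasDerivAt (fun s : ℝ => heatSG T f (x + s • e))
      (Real.sqrt T * pderiv' (heatSG T f) i (x + s • e)) s := fun s => by
    have := (hreg.differentiable (by norm_num) (x + s • e)).hasFDerivAt.comp_hasDerivAt s (hline s)
    simpa [he, pderiv', Function.comp_def] using this
  have hp : ContDiff ℝ 1 (fun y => pderiv' (heatSG T f) i y) :=
    (hreg.fderiv_right (m := 1) (by norm_num)).clm_apply contDiff_const
  have hG2 : HasDerivAt (fun s : ℝ => Real.sqrt T * pderiv' (heatSG T f) i (x + s • e))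
      (T * pderiv' (fun y => pderiv' (heatSG T f) i y) i x) 0 := by
    have := ((hp.differentiable (by norm_num) (x + (0 : ℝ) • e)).hasFDerivAt.comp_hasDerivAt 0
      (hline 0)).const_mul (Real.sqrt T)
    have hTT : Real.sqrt T * Real.sqrt T = T := Real.mul_self_sqrt hT.le
    have hTp : ∀ a : ℝ, T * a = Real.sqrt T * (Real.sqrt T * a) := fun a => by
      rw [← mul_assoc, hTT]
    rw [hTp]
    simpa [he, pderiv'] using this
  have hexp : ∀ s : ℝ, HasDerivAt (fun s : ℝ => Real.exp (-(s ^ 2) / 2))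
      (Real.exp (-(s ^ 2) / 2) * -s) s := fun s => by
    have := (((hasDerivAt_pow 2 s).neg).div_const 2).exp
    convert! this using 2
    simp
    ring
  have hG : (fun s : ℝ => heatSG T f (x + s • e)) = fun s => Real.exp (-(s ^ 2) / 2) *
      ∫ z, ρ z * (z i ^ 0 * Real.exp (s * z i)) := by
    ext s
    simpa using (heatSG_add_single (x := x) hint0 i s).2
  have hG1' : (fun s : ℝ => Real.sqrt T * pderiv' (heatSG T f) i (x + s • e)) = fun s =>
      Real.exp (-(s ^ 2) / 2) * -s * (∫ z, ρ z * (z i ^ 0 * Real.exp (s * z i))) +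
        Real.exp (-(s ^ 2) / 2) * ∫ z, ρ z * (z i ^ (0 + 1) * Real.exp (s * z i)) := by
    ext s
    have h := hG1 s
    rw [hG] at h
    exact h.unique ((hexp s).mul (hder 0 s))
  rw [hG1'] at hG2
  have h2 := ((((hexp 0).mul (hasDerivAt_neg 0)).mul (hder 0 0)).add ((hexp 0).mul (hder 1 0)))
  have h3 := hG2.unique h2
  have h0 : heatSG T f x = ∫ z, ρ z := heatSG_eq_integral_gaussDensity T f x
  simp at h3
  rw [h3, h0]
  ring

end HeatSemigroup

section Hessian

variable {n : ℕ}

theorem ContinuousLinearMap.apply_eq_sum_single (A : (Fin n → ℝ) →L[ℝ] ℝ) (v : Fin n → ℝ) :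
    A v = ∑ i, v i * A (Pi.single i 1) := by
  conv_lhs => rw [← Finset.univ_sum_single v, map_sum]
  refine Finset.sum_congr rfl fun i _ => ?_
  rw [← smul_eq_mul, ← map_smul, ← Pi.single_smul, smul_eq_mul, mul_one]

theorem hessian_eq_fderiv_fderiv {g : (Fin n → ℝ) → ℝ} (hg : ContDiff ℝ 2 g) (x : Fin n → ℝ)
    (i j : Fin n) :
    hessian g x i j = fderiv ℝ (fderiv ℝ g) x (Pi.single i 1) (Pi.single j 1) := by
  have hd : DifferentiableAt ℝ (fderiv ℝ g) x :=
    (hg.fderiv_right (m := 1) (by norm_num)).differentiable (by norm_num) x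
  change fderiv ℝ (fun y => fderiv ℝ g y (Pi.single j 1)) x (Pi.single i 1) = _
  rw [fderiv_clm_apply hd (differentiableAt_const _)]
  simp

theorem hessian_comm {g : (Fin n → ℝ) → ℝ} (hg : ContDiff ℝ 2 g) (x : Fin n → ℝ) (i j : Fin n) :
    hessian g x i j = hessian g x j i := by
  rw [hessian_eq_fderiv_fderiv hg, hessian_eq_fderiv_fderiv hg]
  exact hg.contDiffAt.isSymmSndFDerivAt (by simp) _ _

theorem fderiv_fderiv_eq_sum_hessian {g : (Fin n → ℝ) → ℝ} (hg : ContDiff ℝ 2 g)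
    (x v : Fin n → ℝ) :
    fderiv ℝ (fun y => fderiv ℝ g y v) x v = ∑ i, ∑ j, v i * v j * hessian g x i j := by
  have hd : DifferentiableAt ℝ (fderiv ℝ g) x :=
    (hg.fderiv_right (m := 1) (by norm_num)).differentiable (by norm_num) x
  have h : fderiv ℝ (fun y => fderiv ℝ g y v) x = (fderiv ℝ (fderiv ℝ g) x).flip v := by
    rw [fderiv_clm_apply hd (differentiableAt_const _)]
    simp
  rw [h, ContinuousLinearMap.apply_eq_sum_single]
  refine Finset.sum_congr rfl fun i _ => ?_
  rw [ContinuousLinearMap.flip_apply, ContinuousLinearMap.apply_eq_sum_single, Finset.mul_sum]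
  refine Finset.sum_congr rfl fun j _ => ?_
  rw [hessian_eq_fderiv_fderiv hg, mul_assoc]

theorem contDiff_comp_sub_sum_sq {g : (Fin n → ℝ) → ℝ} (hg : ContDiff ℝ 2 g) (x : Fin n → ℝ)
    (r c : ℝ) : ContDiff ℝ 2 (fun z => g (x + r • z) - (∑ i, z i ^ 2) / 2 - c) := by
  fun_prop

theorem fderiv_fderiv_comp_sub_sum_sq {g : (Fin n → ℝ) → ℝ} (hg : ContDiff ℝ 2 g)
    (x : Fin n → ℝ) (r c : ℝ) (z v : Fin n → ℝ) :
    fderiv ℝ (fun y => fderiv ℝ (fun z => g (x + r • z) - (∑ i, z i ^ 2) / 2 - c) y v) z v =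
      r ^ 2 * (∑ i, ∑ j, v i * v j * hessian g (x + r • z) i j) - ∑ i, v i ^ 2 := by
  have hline : ∀ y : Fin n → ℝ, HasFDerivAt (fun z => x + r • z)
      (r • ContinuousLinearMap.id ℝ (Fin n → ℝ)) y := fun y =>
    ((hasFDerivAt_id y).const_smul r).const_add x
  have hsq : ∀ y : Fin n → ℝ, HasFDerivAt (fun z : Fin n → ℝ => (∑ i, z i ^ 2) / 2)
      (∑ i, y i • ContinuousLinearMap.proj (R := ℝ) (φ := fun _ : Fin n => ℝ) i) y := fun y => by
    have h : HasFDerivAt (fun z : Fin n → ℝ => (2 : ℝ)⁻¹ * ∑ i, z i ^ 2)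
        ((2 : ℝ)⁻¹ • ∑ i, (2 * y i ^ 1) •
          ContinuousLinearMap.proj (R := ℝ) (φ := fun _ : Fin n => ℝ) i) y := by
      refine HasFDerivAt.const_mul (HasFDerivAt.fun_sum fun i _ => ?_) _
      have hi : HasFDerivAt (fun z : Fin n → ℝ => z i)
        (ContinuousLinearMap.proj (R := ℝ) (φ := fun _ : Fin n => ℝ) i) y := hasFDerivAt_apply i y
      simpa using hi.pow 2
    convert! h using 1
    · ext z
      ring
    · simp [Finset.smul_sum, smul_smul]
  have h1 : (fun y => fderiv ℝ (fun z => g (x + r • z) - (∑ i, z i ^ 2) / 2 - c) y v) =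
      fun y => r * fderiv ℝ g (x + r • y) v - ∑ i, v i * y i := by
    ext y
    have hg1 : HasFDerivAt (fun z => g (x + r • z)) _ y :=
      (hg.differentiable (by norm_num) (x + r • y)).hasFDerivAt.comp y (hline y)
    rw [((hg1.fun_sub (hsq y)).sub_const c).fderiv]
    simp [mul_comm]
  have hg' : ContDiff ℝ 1 (fun y => fderiv ℝ g y v) :=
    (hg.fderiv_right (m := 1) (by norm_num)).clm_apply contDiff_const
  have h2 : HasFDerivAt (fun y => r * fderiv ℝ g (x + r • y) v) _ z :=
    ((hg'.differentiable (by norm_num) (x + r • z)).hasFDerivAt.comp z (hline z)).const_mul r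
  have h3 : HasFDerivAt (fun y : Fin n → ℝ => ∑ i, v i * y i)
      (∑ i, v i • ContinuousLinearMap.proj (R := ℝ) (φ := fun _ : Fin n => ℝ) i) z :=
    HasFDerivAt.fun_sum fun i _ => (hasFDerivAt_apply i z).const_mul (v i)
  rw [h1, ← fderiv_fderiv_eq_sum_hessian hg, (h2.fun_sub h3).fderiv]
  simp [sq, mul_assoc]

end Hessian

/-- **The local intrinsic dimensional logarithmic Sobolev inequality on `ℝⁿ`**
(Theorem 9.8, eq. (9.40)): for a smooth positive `f` with `P_T f(x) = 1` and
`dμ/d(P_T δₓ) = f`,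
`H(μ‖P_Tδₓ) ≤ (T/2)·ΔP_T f(x) + (1/2)·P_T f(x)·log det(Idₙ − T·P_T(f ∇²log f)(x)/P_T f(x))`. -/
theorem stmt_14 {n : ℕ} (T : ℝ) (hT : 0 < T) (x : Fin n → ℝ)
    (f : (Fin n → ℝ) → ℝ) (hf : ContDiff ℝ (⊤ : ℕ∞) f) (hfpos : ∀ y, 0 < f y)
    (hnorm : heatSG T f x = 1)
    -- suitable regularity and integrability so that all appearing quantities are finite
    (hreg : ContDiff ℝ (⊤ : ℕ∞) (heatSG T f : (Fin n → ℝ) → ℝ))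
    (hint0 : ∀ y : Fin n → ℝ, Integrable (fun z => f (y + Real.sqrt T • z)) (stdGauss n))
    (hint1 : Integrable (fun z : Fin n → ℝ =>
      f (x + Real.sqrt T • z) * Real.log (f (x + Real.sqrt T • z))) (stdGauss n))
    (hint2 : ∀ i j : Fin n, Integrable (fun z : Fin n → ℝ =>
      f (x + Real.sqrt T • z) *
        hessian (fun y => Real.log (f y)) (x + Real.sqrt T • z) i j) (stdGauss n)) :
    heatSG T (fun y => f y * Real.log (f y)) x - heatSG T f x * Real.log (heatSG T f x) ≤
      (T / 2) * (∑ i : Fin n, pderiv' (fun y => pderiv' (heatSG T f) i y) i x) +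
      (1 / 2 : ℝ) * heatSG T f x * Real.log (Matrix.det
        ((1 : Matrix (Fin n) (Fin n) ℝ) -
          T • Matrix.of fun i j : Fin n =>
            heatSG T (fun y => f y * hessian (fun w => Real.log (f w)) y i j) x /
              heatSG T f x)) := by
  have hfc : Continuous f := hf.continuous
  set ℓ : (Fin n → ℝ) → ℝ := fun y => Real.log (f y) with hℓ
  have hℓ2 : ContDiff ℝ 2 ℓ := (contDiff_infty.1 hf 2).log fun y => (hfpos y).ne'
  set c : ℝ := n * (Real.log (2 * Real.pi) / 2) with hc
  set L : (Fin n → ℝ) → ℝ :=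
    fun z => ℓ (x + Real.sqrt T • z) - (∑ i, z i ^ 2) / 2 - c with hL
  have hexp : ∀ z, Real.exp (L z) = gaussDensity z * f (x + Real.sqrt T • z) := fun z =>
    exp_log_sub_eq_mul_gaussDensity (hfpos _) z
  have hmom := fun i => integral_gaussDensity_mul_sq (x := x) hT hfc hfpos
    (contDiff_infty.1 hreg 2) hint0 i
  simp only [← hexp, hnorm] at hmom
  have hi : Integrable (fun z => Real.exp (L z)) := by
    simpa only [hexp] using integrable_stdGauss_iff.1 (hint0 x)
  have h1 : ∫ z, Real.exp (L z) = 1 := by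
    simpa only [hexp, ← heatSG_eq_integral_gaussDensity] using hnorm
  have hV : Integrable (fun z => Real.exp (L z) * ∑ i, z i ^ 2) := by
    simp only [Finset.mul_sum]
    exact integrable_finsetSum _ fun i _ => (hmom i).1
  have hfl : Integrable (fun z => Real.exp (L z) * ℓ (x + Real.sqrt T • z)) := by
    simpa only [hexp, mul_assoc] using integrable_stdGauss_iff.1 hint1
  have hEeq : (fun z => Real.exp (L z) * L z) = fun z =>
      Real.exp (L z) * ℓ (x + Real.sqrt T • z) - (1 / 2) * (Real.exp (L z) * ∑ i, z i ^ 2) -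
        c * Real.exp (L z) := by
    ext z
    simp only [hL]
    ring
  have hE : Integrable (fun z => Real.exp (L z) * L z) := by
    rw [hEeq]
    exact (hfl.sub (hV.const_mul _)).sub (hi.const_mul _)
  have hEint : ∫ z, Real.exp (L z) * L z =
      heatSG T (fun y => f y * ℓ y) x - (1 / 2) * (n + T * ∑ i : Fin n,
        pderiv' (fun y => pderiv' (heatSG T f) i y) i x) - c := by
    have hVint : ∫ z, Real.exp (L z) * ∑ i, z i ^ 2 =
        n + T * ∑ i : Fin n, pderiv' (fun y => pderiv' (heatSG T f) i y) i x := by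
      simp only [Finset.mul_sum]
      rw [integral_finsetSum _ fun i _ => (hmom i).1, Finset.sum_congr rfl fun i _ => (hmom i).2,
        Finset.sum_add_distrib]
      simp
    rw [hEeq, integral_sub (f := fun z => _ - _) (hfl.sub (hV.const_mul _)) (hi.const_mul _),
      integral_sub hfl (hV.const_mul _), integral_const_mul, integral_const_mul, h1, hVint,
      heatSG_eq_integral_gaussDensity, mul_one]
    simp only [hexp, mul_assoc]
  have hH : ∀ i j : Fin n,
      Integrable (fun z => Real.exp (L z) * hessian ℓ (x + Real.sqrt T • z) i j) := fun i j => by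
    simpa only [hexp, mul_assoc] using integrable_stdGauss_iff.1 (hint2 i j)
  have hHint : ∀ i j : Fin n, heatSG T (fun y => f y * hessian ℓ y i j) x =
      ∫ z, Real.exp (L z) * hessian ℓ (x + Real.sqrt T • z) i j := fun i j => by
    simp only [heatSG_eq_integral_gaussDensity, hexp, mul_assoc]
  set J : Matrix (Fin n) (Fin n) ℝ := (1 : Matrix (Fin n) (Fin n) ℝ) -
    T • Matrix.of fun i j : Fin n => heatSG T (fun y => f y * hessian ℓ y i j) x / heatSG T f x
    with hJ
  have hJherm : J.IsHermitian := by
    refine Matrix.isHermitian_one.sub ?_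
    ext i j
    simp [hHint, hessian_comm hℓ2 _ i j]
  have hD : ∀ v : Fin n → ℝ,
      (fun z => Real.exp (L z) * fderiv ℝ (fun y => fderiv ℝ L y v) z v) = fun z =>
        T * (∑ i, ∑ j, v i * v j * (Real.exp (L z) * hessian ℓ (x + Real.sqrt T • z) i j)) -
          (∑ i, v i ^ 2) * Real.exp (L z) := fun v => by
    ext z
    rw [hL, fderiv_fderiv_comp_sub_sum_sq hℓ2, Real.sq_sqrt hT.le, mul_sub, mul_left_comm,
      Finset.mul_sum, mul_comm (Real.exp _) (∑ i, v i ^ 2)]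
    simp only [Finset.mul_sum, mul_left_comm]
  have hsum : ∀ v : Fin n → ℝ, Integrable (fun z =>
      ∑ i, ∑ j, v i * v j * (Real.exp (L z) * hessian ℓ (x + Real.sqrt T • z) i j)) := fun v =>
    integrable_finsetSum _ fun i _ => integrable_finsetSum _ fun j _ => (hH i j).const_mul _
  have key := integral_exp_mul_le_log_det (contDiff_comp_sub_sum_sq hℓ2 x _ c) hi h1 hE hV hJherm
    (fun v => by
      rw [hD v]
      exact ((hsum v).const_mul T).sub (hi.const_mul _))
    (fun v => by
      rw [hD v, integral_sub ((hsum v).const_mul T) (hi.const_mul _), integral_const_mul,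
        integral_const_mul, h1, integral_finsetSum _ fun i _ =>
          integrable_finsetSum _ fun j _ => (hH i j).const_mul _]
      simp only [integral_finsetSum _ fun j _ => (hH _ j).const_mul _, integral_const_mul, ← hHint]
      rw [hJ, Matrix.sub_mulVec, Matrix.one_mulVec, Matrix.smul_mulVec, dotProduct_sub,
        dotProduct_smul]
      simp only [hnorm, div_one, dotProduct, Matrix.mulVec, Matrix.of_apply, Finset.mul_sum,
        smul_eq_mul]
      rw [neg_sub]
      congr 1
      · refine Finset.sum_congr rfl fun i _ => Finset.sum_congr rfl fun j _ => ?_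
        ring
      · simp only [mul_one, sq])
  rw [hnorm, Real.log_one]
  change ∫ z, Real.exp (L z) * L z ≤ _ at key
  rw [hEint] at key
  linarith
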